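/- arXiv:1606.03950 — 2 statements merged into one kernel-verified Lean document; each statement's English description precedes it below -/
import Mathlib

section
/- Σ_{n=1}^∞ 1/(n² + 16) = -1/32 + (π/8)·coth(4π), and this value is approximately 0.3614490, in particular it is less than 0.3614491. -/
open Real

lemma four_mul_I_mem_integerComplement : 4 * Complex.I ∈ Complex.integerComplement := by
  rintro ⟨n, hn⟩
  simpa using congrArg Complex.im hn

lemma tsum_pnat_one_div_sq_add_sixteen :
    ∑' n : ℕ+, 1 / ((n : ℝ) ^ 2 + 16) =
      -1 / 32 + (π / 8) * (Real.cosh (4 * π) / Real.sinh (4 * π)) := by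
  have hsinh : Real.sinh (4 * π) ≠ 0 := (Real.sinh_pos_iff.2 (by positivity)).ne'
  have hterm (n : ℕ+) : 1 / (4 * Complex.I - n) + 1 / (4 * Complex.I + n) =
      (-8 * Complex.I) * ((1 / ((n : ℝ) ^ 2 + 16) : ℝ) : ℂ) := by
    have hsub : 4 * Complex.I - (n : ℂ) ≠ 0 := fun h ↦ by simpa using congrArg Complex.im h
    have hadd : 4 * Complex.I + (n : ℂ) ≠ 0 := fun h ↦ by simpa using congrArg Complex.im h
    have hsq : (n : ℂ) ^ 2 + 16 = -((4 * Complex.I - n) * (4 * Complex.I + n)) := by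
      linear_combination 16 * Complex.I_sq
    push_cast
    rw [hsq]
    field_simp
    ring
  have hcot : Complex.cot (π * (4 * Complex.I)) =
      -Complex.I * ((Real.cosh (4 * π) / Real.sinh (4 * π) : ℝ) : ℂ) := by
    have hsinh' : Complex.sinh (4 * π) ≠ 0 := by exact_mod_cast hsinh
    have harg : (π : ℂ) * (4 * Complex.I) = (4 * π) * Complex.I := by ring
    rw [harg, Complex.cot, Complex.cos_mul_I, Complex.sin_mul_I]
    push_cast
    field_simp
    simp
  have hseries := cot_series_rep four_mul_I_mem_integerComplement
  simp_rw [hterm] at hseries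
  rw [tsum_mul_left, ← Complex.ofReal_tsum, hcot] at hseries
  have hinv : 1 / (4 * Complex.I) = -Complex.I / 4 := by
    field_simp
    simp
  rw [hinv] at hseries
  generalize ∑' n : ℕ+, 1 / ((n : ℝ) ^ 2 + 16) = S at hseries ⊢
  generalize Real.cosh (4 * π) / Real.sinh (4 * π) = C at hseries ⊢
  have hreal : (S : ℂ) = ((-1 / 32 + π / 8 * C : ℝ) : ℂ) := by
    refine mul_left_cancel₀ (mul_ne_zero (by norm_num) Complex.I_ne_zero : 8 * Complex.I ≠ 0) ?_
    push_cast
    linear_combination hseries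
  exact_mod_cast hreal

lemma cosh_div_sinh_lt_one_add {x : ℝ} (hx : 25 / 2 ≤ x) :
    Real.cosh x / Real.sinh x < 1 + 1 / 10 ^ 9 := by
  have hsinh : 0 < Real.sinh x := Real.sinh_pos_iff.2 (by linarith)
  have hexp : (2.7 : ℝ) ^ 25 ≤ Real.exp x * Real.exp x := by
    calc (2.7 : ℝ) ^ 25 ≤ Real.exp 1 ^ 25 := by
          gcongr
          linarith [Real.exp_one_gt_d9]
      _ = Real.exp 25 := by rw [← Real.exp_nat_mul]; norm_num
      _ ≤ Real.exp (x + x) := Real.exp_le_exp.2 (by linarith)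
      _ = Real.exp x * Real.exp x := Real.exp_add x x
  have hinv : Real.exp x * Real.exp (-x) = 1 := by rw [← Real.exp_add]; simp
  rw [div_lt_iff₀ hsinh, Real.cosh_eq, Real.sinh_eq]
  have hlarge : 3 * 10 ^ 9 * Real.exp (-x) < Real.exp x := by
    refine lt_of_mul_lt_mul_left ?_ (Real.exp_pos x).le
    norm_num at hexp
    linarith
  linarith [Real.exp_pos (-x)]

theorem sum_inv_sq_add_sixteen :
    (∑' n : ℕ+, 1 / ((n : ℝ) ^ 2 + 16) =
      -1 / 32 + (π / 8) * (Real.cosh (4 * π) / Real.sinh (4 * π))) ∧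
    (∑' n : ℕ+, 1 / ((n : ℝ) ^ 2 + 16)) < 0.3614491 := by
  refine ⟨tsum_pnat_one_div_sq_add_sixteen, ?_⟩
  rw [tsum_pnat_one_div_sq_add_sixteen]
  have hcoth := mul_lt_mul_of_pos_left
    (cosh_div_sinh_lt_one_add (x := 4 * π) (by linarith [Real.pi_gt_d2]))
    (by positivity : 0 < π / 8)
  linarith [Real.pi_lt_d20]
end

section
/- If t₁ denotes the minimum of |Im(ρ)| over all nontrivial zeros ρ of the Riemann zeta function, then t₁ > 9.2518015. -/
open Complex Metric Filter Topology Set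

/-- A holomorphic function without zeros on a disc about `0` has a holomorphic logarithm there. -/
lemma exists_eq_mul_exp_of_ne_zero {q : ℂ → ℂ} {R : ℝ} (hR : 0 < R)
    (hq : DifferentiableOn ℂ q (ball 0 R)) (h0 : ∀ z ∈ ball (0 : ℂ) R, q z ≠ 0) :
    ∃ g : ℂ → ℂ, DifferentiableOn ℂ g (ball 0 R) ∧ g 0 = 0 ∧
      ∀ z ∈ ball (0 : ℂ) R, q z = q 0 * exp (g z) := by
  have hd : DifferentiableOn ℂ (fun z ↦ deriv q z / q z) (ball 0 R) :=
    (hq.deriv isOpen_ball).div hq h0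
  obtain ⟨g, hg0, hg⟩ := hd.isExactOn_ball.with_val_at 0 0
  refine ⟨g, fun z hz ↦ (hg z hz).differentiableAt.differentiableWithinAt, hg0, fun z hz ↦ ?_⟩
  have hder : ∀ w ∈ ball (0 : ℂ) R, HasDerivAt (fun w ↦ q w * exp (-g w)) 0 w := by
    intro w hw
    have h1 := (hq.differentiableAt (isOpen_ball.mem_nhds hw)).hasDerivAt.mul (hg w hw).neg.cexp
    convert! h1 using 1
    field_simp [h0 w hw]
    ring
  have hc := isOpen_ball.is_const_of_deriv_eq_zero (convex_ball (0 : ℂ) R).isPreconnected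
    (fun w hw ↦ (hder w hw).differentiableAt.differentiableWithinAt)
    (fun w hw ↦ (hder w hw).deriv) hz (mem_ball_self hR)
  simp only [hg0, neg_zero, exp_zero, mul_one] at hc
  rw [← hc, mul_assoc, ← exp_add]
  simp

/-- If `g 0 = 0` and `Re g ≤ M` on a disc of radius `R`, then `g` is linear up to `O(M / R ^ 2)`. -/
lemma norm_add_one_sub_sub_le {g : ℂ → ℂ} {R M : ℝ} (hM : 0 < M)
    (hg : DifferentiableOn ℂ g (ball 0 R)) (h0 : g 0 = 0) (hre : ∀ z ∈ ball (0 : ℂ) R, (g z).re ≤ M)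
    {s : ℂ} (hR : 2 < R) (hs : ‖s‖ < R / 2) (hs' : ‖1 - s‖ < R / 2) :
    ‖g s + g (1 - s) - g 1‖ ≤ 16 * (‖s‖ ^ 2 + ‖1 - s‖ ^ 2 + 1) * (M / R ^ 2) := by
  have hR0 : 0 < R := by linarith
  have hb : ∀ z ∈ ball (0 : ℂ) (R / 2), ‖g z‖ ≤ 2 * M := by
    intro z hz
    have hz' : ‖z‖ < R / 2 := by simpa using hz
    have hzR : z ∈ ball (0 : ℂ) R := by simp; linarith
    refine (borelCaratheodory_zero hM hg hre hR0 hzR h0).trans ?_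
    rw [div_le_iff₀ (by linarith)]
    gcongr
    linarith
  have hgR : DifferentiableOn ℂ g (ball 0 (R / 2)) := hg.mono (ball_subset_ball (by linarith))
  have hd : ‖deriv g 0‖ ≤ 2 * M / (R / 2) := by
    refine norm_deriv_le_div_of_mapsTo_ball hgR (fun z hz ↦ ?_) (by linarith)
    simpa [h0] using hb z hz
  have key : ∀ z : ℂ, ‖z‖ < R / 2 → ‖g z - deriv g 0 * z‖ ≤ 4 * M * (‖z‖ / (R / 2)) ^ 2 := by
    intro z hz
    have := dist_le_mul_div_pow_of_mapsTo_ball_of_isLittleO (n := 1)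
      (f := fun z ↦ g z - deriv g 0 * z) (c := 0) (z := z) (R₁ := R / 2) (R₂ := 4 * M)
      (hgR.sub (by fun_prop)) ?_ ?_ (by simpa using hz)
    · simpa [h0, dist_eq_norm] using this
    · intro w hw
      have hw' : ‖w‖ < R / 2 := by simpa using hw
      have h1 : ‖deriv g 0 * w‖ ≤ 2 * M := by
        rw [norm_mul]
        calc ‖deriv g 0‖ * ‖w‖ ≤ 2 * M / (R / 2) * (R / 2) := by gcongr
          _ = 2 * M := by field_simp
      have h2 := norm_sub_le (g w) (deriv g 0 * w)
      have h3 := hb w hw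
      simp only [h0, mul_zero, sub_zero, mem_closedBall, dist_zero_right]
      linarith
    · have h1 := (hgR.differentiableAt (ball_mem_nhds (0 : ℂ) (by linarith))).hasDerivAt
      have h2 := h1.isLittleO
      simp only [sub_zero, h0, mul_zero, pow_one] at h2 ⊢
      refine (h2.norm_right).congr_left fun w ↦ ?_
      simp [mul_comm]
  have e1 := key s hs
  have e2 := key (1 - s) hs'
  have e3 := key 1 (by simp; linarith)
  have : g s + g (1 - s) - g 1 = (g s - deriv g 0 * s) + (g (1 - s) - deriv g 0 * (1 - s))
      - (g 1 - deriv g 0 * 1) := by ring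
  rw [this]
  refine (norm_sub_le _ _).trans ((add_le_add (norm_add_le _ _) le_rfl).trans
    ((add_le_add (add_le_add e1 e2) e3).trans (le_of_eq ?_)))
  simp only [norm_one]
  field_simp
  ring

/-- The zeros of an entire function in a disc can be divided out; the quotient does not increase
the maximum on a disc of three times the radius. -/
lemma exists_multiset_eq_mul_prod {f : ℂ → ℂ} (hf : Differentiable ℂ f) (h0 : f 0 ≠ 0) {R B : ℝ}
    (hR : 0 < R) (hB : ∀ z ∈ sphere (0 : ℂ) (3 * R), ‖f z‖ ≤ B) :
    ∃ (S : Multiset ℂ) (q : ℂ → ℂ), Differentiable ℂ q ∧ (∀ ρ ∈ S, f ρ = 0) ∧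
      (∀ z, f z = q z * (S.map fun ρ ↦ 1 - z / ρ).prod) ∧
      (∀ z ∈ closedBall (0 : ℂ) R, q z ≠ 0) ∧ ∀ z ∈ closedBall (0 : ℂ) (3 * R), ‖q z‖ ≤ B := by
  let Good (S : Multiset ℂ) (q : ℂ → ℂ) : Prop := Differentiable ℂ q ∧
    (∀ ρ ∈ S, f ρ = 0 ∧ ‖ρ‖ ≤ R) ∧ (∀ z, f z = q z * (S.map fun ρ ↦ 1 - z / ρ).prod)
  have hprod : ∀ S : Multiset ℂ, (∀ ρ ∈ S, f ρ = 0 ∧ ‖ρ‖ ≤ R) → ∀ z ∈ sphere (0 : ℂ) (3 * R),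
      (2 : ℝ) ^ S.card ≤ ‖(S.map fun ρ ↦ 1 - z / ρ).prod‖ := by
    intro S
    induction S using Multiset.induction_on with
    | empty => simp
    | cons ρ S ih =>
      intro hS z hz
      have h1 := ih (fun ρ' h ↦ hS ρ' (Multiset.mem_cons_of_mem h)) z hz
      obtain ⟨hρ, hρR⟩ := hS ρ (Multiset.mem_cons_self _ _)
      have hρ0 : 0 < ‖ρ‖ := norm_pos_iff.2 (by rintro rfl; exact h0 hρ)
      have hz' : ‖z‖ = 3 * R := by simpa using hz
      have h2 : 2 ≤ ‖1 - z / ρ‖ := by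
        have h3 : 3 ≤ ‖z / ρ‖ := by
          rw [norm_div, hz', le_div_iff₀ hρ0]; linarith
        have h4 := norm_sub_norm_le (z / ρ) 1
        rw [norm_sub_rev, norm_one] at h4
        linarith
      rw [Multiset.card_cons, Multiset.map_cons, Multiset.prod_cons, norm_mul, pow_succ, mul_comm]
      gcongr
  have hbound : ∀ S q, Good S q → ∀ z ∈ closedBall (0 : ℂ) (3 * R),
      ‖q z‖ ≤ B / 2 ^ S.card := by
    rintro S q ⟨hq, hS, hfq⟩ z hz
    refine norm_le_of_forall_mem_frontier_norm_le (U := ball (0 : ℂ) (3 * R)) isBounded_ball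
      hq.diffContOnCl (fun w hw ↦ ?_) (by rwa [closure_ball _ (by positivity)])
    rw [frontier_ball _ (by positivity)] at hw
    rw [le_div_iff₀ (by positivity)]
    refine le_trans ?_ (hB w hw)
    rw [hfq w, norm_mul]
    gcongr
    exact hprod S hS w hw
  have hcard : ∀ S q, Good S q → (2 : ℝ) ^ S.card ≤ B / ‖f 0‖ := by
    intro S q hg
    have h1 := hbound S q hg 0 (by simp; positivity)
    have h2 := hg.2.2 0
    simp only [zero_div, sub_zero, Multiset.map_const', Multiset.prod_replicate, one_pow,
      mul_one] at h2
    rw [← h2, le_div_iff₀ (by positivity)] at h1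
    rw [le_div_iff₀ (norm_pos_iff.2 h0)]
    linarith
  obtain ⟨m, hm⟩ := pow_unbounded_of_one_lt (B / ‖f 0‖) (one_lt_two (α := ℝ))
  have hlt : ∀ n, (∃ S q, Good S q ∧ S.card = n) → n ≤ m := by
    rintro n ⟨S, q, hg, rfl⟩
    by_contra! h
    have := hcard S q hg
    have h3 : (2 : ℝ) ^ m ≤ 2 ^ S.card := pow_le_pow_right₀ one_le_two h.le
    linarith
  classical
  have hex : ∃ n, n ≤ m ∧ ∃ S q, Good S q ∧ S.card = n :=
    ⟨0, Nat.zero_le _, 0, f, ⟨hf, by simp, by simp⟩, rfl⟩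
  obtain ⟨n, ⟨-, S, q, hg, hn⟩, hmax⟩ : ∃ n, (n ≤ m ∧ ∃ S q, Good S q ∧ S.card = n) ∧
      ∀ k, (k ≤ m ∧ ∃ S q, Good S q ∧ S.card = k) → k ≤ n := by
    obtain ⟨k, hkm, hk⟩ := hex
    exact ⟨_, Nat.findGreatest_spec (P := fun n ↦ n ≤ m ∧ ∃ S q, Good S q ∧ S.card = n) hkm
      ⟨hkm, hk⟩, fun j hj ↦ Nat.le_findGreatest hj.1 hj⟩
  refine ⟨S, q, hg.1, fun ρ h ↦ (hg.2.1 ρ h).1, hg.2.2, fun z hz hqz ↦ ?_, fun z hz ↦ ?_⟩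
  · have hfz : f z = 0 := by rw [hg.2.2 z, hqz, zero_mul]
    have hz0 : z ≠ 0 := by rintro rfl; exact h0 hfz
    have hnew : Good (z ::ₘ S) (fun w ↦ -z * dslope q z w) := by
      refine ⟨?_, ?_, fun w ↦ ?_⟩
      · have : Differentiable ℂ (dslope q z) := by
          rw [← differentiableOn_univ, differentiableOn_dslope univ_mem, differentiableOn_univ]
          exact hg.1
        exact this.const_mul _
      · intro ρ hρ
        rcases Multiset.mem_cons.1 hρ with rfl | h
        · exact ⟨hfz, by simpa using hz⟩
        · exact hg.2.1 ρ h
      · have h1 := sub_smul_dslope q z w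
        rw [hqz, sub_zero, smul_eq_mul] at h1
        rw [hg.2.2 w, Multiset.map_cons, Multiset.prod_cons, ← mul_assoc, ← h1]
        congr 1
        field_simp
        ring
    have h1 := hlt _ ⟨_, _, hnew, rfl⟩
    have h2 := hmax _ ⟨h1, _, _, hnew, rfl⟩
    rw [Multiset.card_cons] at h2
    lia
  · refine (hbound S q hg z hz).trans (div_le_self ?_ (one_le_pow₀ one_le_two))
    exact (norm_nonneg _).trans (hB (3 * R : ℝ) (by simp [abs_of_pos hR]))

/-- A finite-disc form of the Hadamard factorization of `s ↦ f s * f (1 - s)`, with an error term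
controlled by the growth of `f`. -/
lemma exists_multiset_mul_one_sub_eq {f : ℂ → ℂ} (hf : Differentiable ℂ f) (h0 : f 0 = 1)
    (h1 : f 1 = 1) {R B : ℝ} (hR : 2 < R) (hB0 : 0 < B)
    (hB : ∀ z ∈ sphere (0 : ℂ) (3 * R), ‖f z‖ ≤ Real.exp B) :
    ∃ S : Multiset ℂ, (∀ ρ ∈ S, f ρ = 0) ∧ (∀ ρ, f ρ = 0 → ‖ρ‖ ≤ R → ρ ∈ S) ∧
      ∀ s : ℂ, ‖s‖ < R / 2 → ‖1 - s‖ < R / 2 → ∃ h : ℂ,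
        ‖h‖ ≤ 16 * (‖s‖ ^ 2 + ‖1 - s‖ ^ 2 + 1) * (B / R ^ 2) ∧
        f s * f (1 - s) = (S.map fun ρ ↦ 1 + s * (s - 1) / (ρ * (1 - ρ))).prod * exp h := by
  have hR0 : 0 < R := by linarith
  obtain ⟨S, q, hq, hS, hfq, hq0, hqB⟩ :=
    exists_multiset_eq_mul_prod hf (by simp [h0]) hR0 hB
  obtain ⟨g, hg, hg0, hqg⟩ := exists_eq_mul_exp_of_ne_zero hR0 hq.differentiableOn
    (fun z hz ↦ hq0 z (ball_subset_closedBall hz))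
  have hq1 : q 0 = 1 := by
    have := hfq 0
    simpa [h0] using this.symm
  have hre : ∀ z ∈ ball (0 : ℂ) R, (g z).re ≤ B := by
    intro z hz
    have h2 := hqB z (by simp at hz ⊢; linarith)
    rwa [hqg z hz, hq1, one_mul, norm_exp, Real.exp_le_exp] at h2
  have hfg : ∀ z ∈ ball (0 : ℂ) R, f z = exp (g z) * (S.map fun ρ ↦ 1 - z / ρ).prod := by
    intro z hz
    rw [hfq z, hqg z hz, hq1, one_mul]
  refine ⟨S, hS, fun ρ hρ hρR ↦ ?_, fun s hs hs' ↦
    ⟨_, norm_add_one_sub_sub_le hB0 hg hg0 hre hR hs hs', ?_⟩⟩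
  · have h2 := hfq ρ
    rw [hρ, eq_comm, mul_eq_zero, or_iff_right (hq0 ρ (by simpa using hρR)),
      Multiset.prod_eq_zero_iff, Multiset.mem_map] at h2
    obtain ⟨ρ', hρ', h3⟩ := h2
    have h4 : ρ' ≠ 0 := by rintro rfl; simp at h3
    rw [sub_eq_zero, eq_comm, div_eq_one_iff_eq h4] at h3
    rwa [h3]
  · have e1 : (1 : ℂ) = exp (g 1) * (S.map fun ρ ↦ 1 - 1 / ρ).prod := by
      rw [← hfg 1 (by simp; linarith), h1]
    have hP1 : (S.map fun ρ ↦ 1 - 1 / ρ).prod ≠ 0 := by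
      intro h; rw [h, mul_zero] at e1; exact one_ne_zero e1
    rw [hfg s (by simp; linarith), hfg (1 - s) (by simp; linarith)]
    have e2 : (S.map fun ρ ↦ 1 - s / ρ).prod * (S.map fun ρ ↦ 1 - (1 - s) / ρ).prod =
        (S.map fun ρ ↦ 1 + s * (s - 1) / (ρ * (1 - ρ))).prod * (S.map fun ρ ↦ 1 - 1 / ρ).prod := by
      rw [← Multiset.prod_map_mul, ← Multiset.prod_map_mul]
      refine congrArg _ (Multiset.map_congr rfl fun ρ hρ ↦ ?_)
      have h2 : ρ ≠ 0 := by rintro rfl; simp [hS 0 hρ] at h0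
      have h3 : 1 - ρ ≠ 0 := by
        intro h
        rw [← sub_eq_zero.1 h] at hρ
        simp [hS 1 hρ] at h1
      field_simp
      ring
    rw [exp_sub, exp_add]
    calc _ = exp (g s) * exp (g (1 - s)) * ((S.map fun ρ ↦ 1 - s / ρ).prod *
          (S.map fun ρ ↦ 1 - (1 - s) / ρ).prod) := by ring
      _ = _ := by
        rw [e2]
        have : exp (g 1) = 1 / (S.map fun ρ ↦ 1 - 1 / ρ).prod := by
          field_simp; exact e1.symm
        rw [this]
        field_simp

lemma exists_norm_sq_mul_one_sub_eq {ρ : ℂ} (h0 : 0 < ρ.re) (h1 : ρ.re < 1) :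
    ∃ n X : ℝ, 0 < n ∧ 0 < X ∧ n ≤ X ^ 2 + X ∧ X ≤ 1 / 4 + ρ.im ^ 2 ∧
      ‖ρ * (1 - ρ)‖ ^ 2 = n ∧ ‖ρ * (1 - ρ) + 2‖ ^ 2 = n + 4 * X + 4 ∧
      ‖ρ * (1 - ρ) + 12‖ ^ 2 = n + 24 * X + 144 := by
  obtain ⟨σ, t⟩ := ρ
  simp only at h0 h1 ⊢
  have hσ : 0 < σ * (1 - σ) := mul_pos h0 (by linarith)
  refine ⟨(σ * (1 - σ) + t ^ 2) ^ 2 + (t * (1 - 2 * σ)) ^ 2, σ * (1 - σ) + t ^ 2,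
    by positivity, by positivity, ?_, ?_, ?_, ?_, ?_⟩
  · nlinarith [mul_nonneg hσ.le (sq_nonneg t)]
  · nlinarith [sq_nonneg (1 - 2 * σ)]
  all_goals
    rw [Complex.sq_norm, Complex.normSq_apply]
    simp
    ring

lemma add_pow_six_ge {n X : ℝ} (hn : 0 < n) (hX : 0 < X) (hnX : n ≤ X ^ 2 + X) :
    (n + 24 * X + 144) * n ^ 5 + 120 * n ^ 5 ≤ (n + 4 * X + 4) ^ 6 := by
  have h1 : 240 * n ^ 4 * n ≤ 240 * n ^ 4 * (X + 1) ^ 2 := by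
    gcongr
    nlinarith
  have h2 : (n + 4 * X + 4) ^ 6 - (n ^ 6 + 24 * n ^ 5 * (X + 1) + 240 * n ^ 4 * (X + 1) ^ 2) =
      20 * n ^ 3 * (4 * (X + 1)) ^ 3 + 15 * n ^ 2 * (4 * (X + 1)) ^ 4 +
        6 * n * (4 * (X + 1)) ^ 5 + (4 * (X + 1)) ^ 6 := by ring
  have h3 : 0 ≤ 20 * n ^ 3 * (4 * (X + 1)) ^ 3 + 15 * n ^ 2 * (4 * (X + 1)) ^ 4 +
        6 * n * (4 * (X + 1)) ^ 5 + (4 * (X + 1)) ^ 6 := by positivity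
  nlinarith

lemma norm_one_add_div_le {b : ℂ} {c : ℝ} (hb : b ≠ 0)
    (h : c ^ 2 * (‖b + 12‖ ^ 2 * (‖b‖ ^ 2) ^ 5) ≤ (‖b + 2‖ ^ 2) ^ 6) :
    c * ‖1 + 12 / b‖ ≤ ‖1 + 2 / b‖ ^ 6 := by
  have hb' : 0 < ‖b‖ := norm_pos_iff.2 hb
  have e1 : ‖1 + 12 / b‖ = ‖b + 12‖ / ‖b‖ := by rw [← norm_div]; congr 1; field_simp
  have e2 : ‖1 + 2 / b‖ = ‖b + 2‖ / ‖b‖ := by rw [← norm_div]; congr 1; field_simp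
  have h' : c * (‖b + 12‖ * ‖b‖ ^ 5) ≤ ‖b + 2‖ ^ 6 := by
    refine le_of_sq_le_sq ?_ (by positivity)
    convert! h using 1 <;> ring
  rw [e1, e2, div_pow, ← mul_div_assoc, div_le_div_iff₀ hb' (by positivity)]
  calc c * ‖b + 12‖ * ‖b‖ ^ 6 = c * (‖b + 12‖ * ‖b‖ ^ 5) * ‖b‖ := by ring
    _ ≤ _ := by gcongr

lemma norm_one_add_div_mul_one_sub_le {ρ : ℂ} (h0 : 0 < ρ.re) (h1 : ρ.re < 1) :
    ‖1 + 12 / (ρ * (1 - ρ))‖ ≤ ‖1 + 2 / (ρ * (1 - ρ))‖ ^ 6 := by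
  obtain ⟨n, X, hn, hX, hnX, -, e1, e2, e3⟩ := exists_norm_sq_mul_one_sub_eq h0 h1
  rw [← one_mul ‖1 + 12 / (ρ * (1 - ρ))‖]
  refine norm_one_add_div_le (fun h ↦ ?_) ?_
  · simp [h] at e1; linarith
  · rw [e1, e2, e3]
    have := add_pow_six_ge hn hX hnX
    have h5 : 0 < n ^ 5 := by positivity
    linarith

lemma norm_one_add_div_mul_one_sub_le_of_abs_im_le {ρ : ℂ} (h0 : 0 < ρ.re) (h1 : ρ.re < 1)
    (ht : |ρ.im| ≤ 9.3) :
    1.006 * ‖1 + 12 / (ρ * (1 - ρ))‖ ≤ ‖1 + 2 / (ρ * (1 - ρ))‖ ^ 6 := by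
  obtain ⟨n, X, hn, hX, hnX, hXt, e1, e2, e3⟩ := exists_norm_sq_mul_one_sub_eq h0 h1
  refine norm_one_add_div_le (fun h ↦ ?_) ?_
  · simp [h] at e1; linarith
  · rw [e1, e2, e3]
    have := add_pow_six_ge hn hX hnX
    have h5 : 0 < n ^ 5 := by positivity
    have ht2 : ρ.im ^ 2 ≤ 9.3 ^ 2 := sq_le_sq' (abs_le.1 ht).1 (abs_le.1 ht).2
    have hX' : X ≤ 86.74 := by norm_num at ht2 ⊢; linarith
    have hn' : n ≤ 86.74 ^ 2 + 86.74 := hnX.trans (by gcongr)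
    have h6 : (n + 24 * X + 144) * n ^ 5 ≤ 9840 * n ^ 5 := by
      gcongr
      norm_num at hX' hn' ⊢
      linarith
    norm_num at h6 ⊢
    linarith

/-- Comparison of `f` at the points `2` and `4` for an entire function `f` of order less than `2`
all of whose zeros lie in the critical strip. -/
lemma mul_norm_le_of_zero {f : ℂ → ℂ} (hf : Differentiable ℂ f) (h0 : f 0 = 1) (h1 : f 1 = 1)
    (hz : ∀ ρ, f ρ = 0 → 0 < ρ.re ∧ ρ.re < 1) {B : ℕ → ℝ} (hB0 : ∀ᶠ N in atTop, 0 < B N)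
    (hB : ∀ᶠ N : ℕ in atTop, ∀ z ∈ sphere (0 : ℂ) (3 * N), ‖f z‖ ≤ Real.exp (B N))
    (hlim : Tendsto (fun N : ℕ ↦ B N / (N : ℝ) ^ 2) atTop (𝓝 0)) {ρ₀ : ℂ} (hρ : f ρ₀ = 0) {c : ℝ}
    (hc : c * ‖1 + 12 / (ρ₀ * (1 - ρ₀))‖ ≤ ‖1 + 2 / (ρ₀ * (1 - ρ₀))‖ ^ 6) :
    c * ‖f 4 * f (-3)‖ ≤ ‖f 2 * f (-1)‖ ^ 6 := by
  have hprod : ∀ S : Multiset ℂ, (∀ ρ ∈ S, f ρ = 0) → ρ₀ ∈ S →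
      c * ‖(S.map fun ρ ↦ 1 + 12 / (ρ * (1 - ρ))).prod‖ ≤
        ‖(S.map fun ρ ↦ 1 + 2 / (ρ * (1 - ρ))).prod‖ ^ 6 := by
    intro S hS hρS
    obtain ⟨T, rfl⟩ := Multiset.exists_cons_of_mem hρS
    have hT : ‖(T.map fun ρ ↦ 1 + 12 / (ρ * (1 - ρ))).prod‖ ≤
        ‖(T.map fun ρ ↦ 1 + 2 / (ρ * (1 - ρ))).prod‖ ^ 6 := by
      rw [← norm_pow, ← Multiset.prod_map_pow]
      have hn : ∀ (U : Multiset ℂ) (F : ℂ → ℂ), ‖(U.map F).prod‖ = (U.map fun ρ ↦ ‖F ρ‖).prod := by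
        intro U F
        rw [← normHom_apply, map_multiset_prod, Multiset.map_map]
        simp
      rw [hn, hn]
      refine Multiset.prod_map_le_prod_map₀ _ _ (fun _ _ ↦ norm_nonneg _) fun ρ h ↦ ?_
      obtain ⟨h2, h3⟩ := hz ρ (hS ρ (Multiset.mem_cons_of_mem h))
      rw [norm_pow]
      exact norm_one_add_div_mul_one_sub_le h2 h3
    simp only [Multiset.map_cons, Multiset.prod_cons, norm_mul, mul_pow]
    rw [← mul_assoc]
    gcongr
  have hev : ∀ᶠ N : ℕ in atTop, c * ‖f 4 * f (-3)‖ ≤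
      ‖f 2 * f (-1)‖ ^ 6 * Real.exp (16 * 182 * (B N / (N : ℝ) ^ 2)) := by
    filter_upwards [hB0, hB, eventually_gt_atTop 8, eventually_ge_atTop ⌈‖ρ₀‖⌉₊]
      with N hN0 hNB hN8 hNρ
    have hN8' : (8 : ℝ) < N := by exact_mod_cast hN8
    obtain ⟨S, hS, hS', hSf⟩ := exists_multiset_mul_one_sub_eq hf h0 h1 (R := N)
      (by linarith) hN0 hNB
    have hρS := hS' ρ₀ hρ (Nat.ceil_le.1 hNρ)
    obtain ⟨a, ha, hfa⟩ := hSf 2 (by norm_num; linarith) (by norm_num; linarith)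
    obtain ⟨b, hb, hfb⟩ := hSf 4 (by norm_num; linarith) (by norm_num; linarith)
    norm_num at ha hb hfa hfb
    have hp := hprod S hS hρS
    have hx : 0 ≤ B N / (N : ℝ) ^ 2 := by positivity
    rw [hfa, hfb, norm_mul, norm_mul, norm_exp, norm_exp]
    have ha' := (abs_le.1 ((abs_re_le_norm a).trans ha)).1
    have hb' := (abs_le.1 ((abs_re_le_norm b).trans hb)).2
    calc _ = c * ‖(S.map fun ρ ↦ 1 + 12 / (ρ * (1 - ρ))).prod‖ * Real.exp b.re := by ring
      _ ≤ ‖(S.map fun ρ ↦ 1 + 2 / (ρ * (1 - ρ))).prod‖ ^ 6 *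
          Real.exp (6 * a.re + 16 * 182 * (B N / (N : ℝ) ^ 2)) := by
        gcongr
        linarith
      _ = _ := by rw [Real.exp_add, mul_pow, ← Real.exp_nat_mul]; push_cast; ring
  refine ge_of_tendsto ?_ hev
  have h2 : Tendsto (fun N : ℕ ↦ Real.exp (16 * 182 * (B N / (N : ℝ) ^ 2))) atTop (𝓝 1) := by
    have := (Real.continuous_exp.tendsto _).comp (hlim.const_mul (16 * 182))
    simpa [Function.comp_def] using this
  simpa using h2.const_mul (‖f 2 * f (-1)‖ ^ 6)

/-- An entire function of order less than `2` without zeros, normalized at `0` and `1`, satisfies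
`f s * f (1 - s) = 1`. -/
lemma mul_one_sub_eq_one_of_ne_zero {f : ℂ → ℂ} (hf : Differentiable ℂ f) (h0 : f 0 = 1)
    (h1 : f 1 = 1) (hz : ∀ ρ, f ρ ≠ 0) {B : ℕ → ℝ} (hB0 : ∀ᶠ N in atTop, 0 < B N)
    (hB : ∀ᶠ N : ℕ in atTop, ∀ z ∈ sphere (0 : ℂ) (3 * N), ‖f z‖ ≤ Real.exp (B N))
    (hlim : Tendsto (fun N : ℕ ↦ B N / (N : ℝ) ^ 2) atTop (𝓝 0)) (s : ℂ) :
    f s * f (1 - s) = 1 := by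
  have hev : ∀ᶠ N : ℕ in atTop, ∃ h : ℂ,
      ‖h‖ ≤ 16 * (‖s‖ ^ 2 + ‖1 - s‖ ^ 2 + 1) * (B N / (N : ℝ) ^ 2) ∧
        f s * f (1 - s) = exp h := by
    filter_upwards [hB0, hB, eventually_gt_atTop 2, eventually_gt_atTop ⌈2 * ‖s‖⌉₊,
      eventually_gt_atTop ⌈2 * ‖1 - s‖⌉₊] with N hN0 hNB hN2 hNs hNs'
    replace hNs := (Nat.le_ceil _).trans_lt (Nat.cast_lt (α := ℝ).2 hNs)
    replace hNs' := (Nat.le_ceil _).trans_lt (Nat.cast_lt (α := ℝ).2 hNs')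
    obtain ⟨S, hS, -, hSf⟩ := exists_multiset_mul_one_sub_eq hf h0 h1 (R := N)
      (by exact_mod_cast hN2) hN0 hNB
    have hS0 : S = 0 := Multiset.eq_zero_of_forall_notMem fun ρ h ↦ hz ρ (hS ρ h)
    obtain ⟨h, hh, hfh⟩ := hSf s (by linarith) (by linarith)
    exact ⟨h, hh, by simpa [hS0] using hfh⟩
  obtain ⟨N₀, hN₀⟩ := eventually_atTop.1 hev
  choose! h hh hfh using hN₀
  have hlim' : Tendsto h atTop (𝓝 0) := by
    refine squeeze_zero_norm' (eventually_atTop.2 ⟨N₀, hh⟩) ?_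
    simpa using hlim.const_mul (16 * (‖s‖ ^ 2 + ‖1 - s‖ ^ 2 + 1))
  have h2 := (continuous_exp.tendsto 0).comp hlim'
  rw [exp_zero] at h2
  refine tendsto_nhds_unique (tendsto_const_nhds.congr' ?_) h2
  exact eventually_atTop.2 ⟨N₀, fun N hN ↦ hfh N hN⟩

/-- `completedRiemannZeta₀` is bounded in vertical strips. -/
lemma exists_norm_completedRiemannZeta₀_le (a b : ℝ) :
    ∃ C, ∀ s : ℂ, a ≤ s.re → s.re ≤ b → ‖completedRiemannZeta₀ s‖ ≤ C := by
  set P := HurwitzZeta.hurwitzEvenFEPair 0 with hP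
  have hconv : ∀ s : ℂ, MellinConvergent P.f_modif s := fun s ↦
    (P.isStrongFEPair_toStrongFEPair.hasMellin s).1
  have hint : ∀ c : ℝ, MeasureTheory.IntegrableOn
      (fun x : ℝ ↦ x ^ (c / 2 - 1) * ‖P.f_modif x‖) (Ioi 0) := by
    intro c
    refine MeasureTheory.IntegrableOn.congr_fun (hconv ((c / 2 : ℝ) : ℂ)).norm
      (fun x hx ↦ ?_) measurableSet_Ioi
    simp only [norm_smul, norm_cpow_eq_rpow_re_of_pos (mem_Ioi.1 hx)]
    simp
  refine ⟨(∫ x in Ioi (0 : ℝ), (x ^ (a / 2 - 1) * ‖P.f_modif x‖ +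
    x ^ (b / 2 - 1) * ‖P.f_modif x‖)) / 2, fun s ha hb ↦ ?_⟩
  have e : completedRiemannZeta₀ s = mellin P.f_modif (s / 2) / 2 := rfl
  rw [e, norm_div, Complex.norm_ofNat]
  gcongr
  refine MeasureTheory.norm_integral_le_of_norm_le ((hint a).add (hint b)) ?_
  refine (MeasureTheory.ae_restrict_iff' measurableSet_Ioi).2 (Eventually.of_forall fun x hx ↦ ?_)
  have hx0 : 0 < x := hx
  rw [norm_smul, norm_cpow_eq_rpow_re_of_pos hx0, ← add_mul]
  gcongr
  have hre : (s / 2 - 1).re = s.re / 2 - 1 := by simp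
  rw [hre]
  rcases le_total 1 x with h | h
  · have := Real.rpow_le_rpow_of_exponent_le h (by linarith : s.re / 2 - 1 ≤ b / 2 - 1)
    have := Real.rpow_nonneg hx0.le (a / 2 - 1)
    linarith
  · have := Real.rpow_le_rpow_of_exponent_ge hx0 h (by linarith : a / 2 - 1 ≤ s.re / 2 - 1)
    have := Real.rpow_nonneg hx0.le (b / 2 - 1)
    linarith

lemma norm_Gamma_le_Gamma_re {s : ℂ} (hs : 0 < s.re) : ‖Gamma s‖ ≤ Real.Gamma s.re := by
  rw [Gamma_eq_integral hs, Real.Gamma_eq_integral hs, GammaIntegral]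
  refine MeasureTheory.norm_integral_le_of_norm_le (Real.GammaIntegral_convergent hs) ?_
  refine (MeasureTheory.ae_restrict_iff' measurableSet_Ioi).2 (Eventually.of_forall fun x hx ↦ ?_)
  rw [norm_mul, norm_cpow_eq_rpow_re_of_pos hx, norm_real, Real.norm_eq_abs,
    abs_of_pos (Real.exp_pos _)]
  simp

lemma Real.Gamma_le_factorial {x : ℝ} (hx : 1 ≤ x) {n : ℕ} (hn : x ≤ n) :
    Real.Gamma x ≤ n.factorial := by
  have h1 : Real.Gamma x ≤ Real.Gamma (x + 1) := by
    rw [Real.Gamma_add_one (by linarith)]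
    exact le_mul_of_one_le_left (Real.Gamma_pos_of_pos (by linarith)).le hx
  rw [← Real.Gamma_nat_eq_factorial]
  refine h1.trans (Real.Gamma_strictMonoOn_Ici.monotoneOn ?_ ?_ ?_) <;> simp <;> linarith

lemma norm_riemannZeta_le {s : ℂ} (hs : 2 ≤ s.re) : ‖riemannZeta s‖ ≤ ∑' n : ℕ, 1 / (n : ℝ) ^ 2 := by
  rw [zeta_eq_tsum_one_div_nat_cpow (by linarith)]
  refine tsum_of_norm_bounded (Real.summable_one_div_nat_pow.2 one_lt_two).hasSum fun n ↦ ?_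
  rcases Nat.eq_zero_or_pos n with rfl | hn
  · rw [Nat.cast_zero, zero_cpow (by rintro rfl; norm_num at hs)]
    simp
  · rw [norm_div, norm_one, norm_natCast_cpow_of_pos hn, ← Real.rpow_natCast]
    gcongr
    · exact_mod_cast hn
    · exact_mod_cast hs

lemma norm_completedRiemannZeta₀_le_factorial {s : ℂ} (hs : 2 ≤ s.re) {n : ℕ} (hn : s.re / 2 ≤ n) :
    ‖completedRiemannZeta₀ s‖ ≤ (∑' n : ℕ, 1 / (n : ℝ) ^ 2) * n.factorial + 2 := by
  have hs0 : s ≠ 0 := by rintro rfl; norm_num at hs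
  have hG : ‖Gammaℝ s‖ ≤ n.factorial := by
    rw [Gammaℝ_def, norm_mul, norm_cpow_eq_rpow_re_of_pos Real.pi_pos]
    have h1 : Real.pi ^ (-s / 2).re ≤ 1 :=
      Real.rpow_le_one_of_one_le_of_nonpos (by linarith [Real.pi_gt_three]) (by simp; linarith)
    have hre : (s / 2).re = s.re / 2 := by simp
    have h2 : ‖Gamma (s / 2)‖ ≤ n.factorial := by
      refine (norm_Gamma_le_Gamma_re (by rw [hre]; linarith)).trans ?_
      rw [hre]
      exact Real.Gamma_le_factorial (by linarith) hn
    calc _ ≤ 1 * (n.factorial : ℝ) := by gcongr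
      _ = _ := one_mul _
  have e : completedRiemannZeta₀ s = riemannZeta s * Gammaℝ s + 1 / s + 1 / (1 - s) := by
    rw [riemannZeta_def_of_ne_zero hs0,
      div_mul_cancel₀ _ (Gammaℝ_ne_zero_of_re_pos (by linarith)), completedRiemannZeta_eq]
    ring
  have h1 : ‖1 / s‖ ≤ 1 := by
    rw [norm_div, norm_one]
    refine div_le_one_of_le₀ ?_ (norm_nonneg _)
    linarith [re_le_norm s]
  have h2 : ‖1 / (1 - s)‖ ≤ 1 := by
    rw [norm_div, norm_one]
    refine div_le_one_of_le₀ ?_ (norm_nonneg _)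
    rw [norm_sub_rev]
    have := re_le_norm (s - 1)
    simp at this
    linarith
  rw [e]
  refine (norm_add₃_le).trans ?_
  rw [norm_mul]
  have h3 := mul_le_mul (norm_riemannZeta_le hs) hG (norm_nonneg _)
    ((norm_nonneg _).trans (norm_riemannZeta_le hs))
  linarith

/-- Twice Riemann's `ξ` function. -/
noncomputable def twoXi (s : ℂ) : ℂ := s * (s - 1) * completedRiemannZeta₀ s + 1

lemma twoXi_zero : twoXi 0 = 1 := by simp [twoXi]

lemma twoXi_one : twoXi 1 = 1 := by simp [twoXi]

lemma differentiable_twoXi : Differentiable ℂ twoXi := by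
  unfold twoXi
  have := differentiable_completedZeta₀
  fun_prop

lemma twoXi_one_sub (s : ℂ) : twoXi (1 - s) = twoXi s := by
  rw [twoXi, twoXi, completedRiemannZeta₀_one_sub]
  ring

lemma twoXi_eq_of_re_pos {s : ℂ} (hs : 0 < s.re) (hs1 : s ≠ 1) :
    twoXi s = s * (s - 1) * (Gammaℝ s * riemannZeta s) := by
  have hs0 : s ≠ 0 := by rintro rfl; simp at hs
  have hs1' : 1 - s ≠ 0 := sub_ne_zero.2 hs1.symm
  rw [riemannZeta_def_of_ne_zero hs0, mul_div_cancel₀ _ (Gammaℝ_ne_zero_of_re_pos hs),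
    completedRiemannZeta_eq, twoXi]
  field_simp
  ring

lemma twoXi_ne_zero_of_one_le_re {s : ℂ} (hs : 1 ≤ s.re) : twoXi s ≠ 0 := by
  by_cases hs1 : s = 1
  · simp [hs1, twoXi_one]
  · rw [twoXi_eq_of_re_pos (by linarith) hs1]
    refine mul_ne_zero (mul_ne_zero ?_ (sub_ne_zero.2 hs1)) (mul_ne_zero
      (Gammaℝ_ne_zero_of_re_pos (by linarith)) (riemannZeta_ne_zero_of_one_le_re hs))
    rintro rfl
    norm_num at hs

lemma re_mem_Ioo_of_twoXi_eq_zero {ρ : ℂ} (h : twoXi ρ = 0) : 0 < ρ.re ∧ ρ.re < 1 := by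
  constructor
  · by_contra! h0
    refine twoXi_ne_zero_of_one_le_re (s := 1 - ρ) (by simp; exact h0) ?_
    rw [twoXi_one_sub, h]
  · by_contra! h1
    exact twoXi_ne_zero_of_one_le_re h1 h

lemma twoXi_eq_zero_iff {ρ : ℂ} (h0 : 0 < ρ.re) (h1 : ρ.re < 1) :
    twoXi ρ = 0 ↔ riemannZeta ρ = 0 := by
  have hρ1 : ρ ≠ 1 := by rintro rfl; simp at h1
  have hρ0 : ρ ≠ 0 := by rintro rfl; simp at h0
  rw [twoXi_eq_of_re_pos h0 hρ1]
  simp [hρ0, sub_ne_zero.2 hρ1, Gammaℝ_ne_zero_of_re_pos h0]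

lemma twoXi_two : twoXi 2 = (Real.pi / 3 : ℝ) := by
  rw [twoXi_eq_of_re_pos (by simp) (by norm_num), riemannZeta_two, Gammaℝ_def]
  have hpi : (Real.pi : ℂ) ≠ 0 := by exact_mod_cast Real.pi_ne_zero
  have h1 : (Real.pi : ℂ) ^ (-2 / 2 : ℂ) = (Real.pi : ℂ)⁻¹ := by
    rw [neg_div, div_self two_ne_zero, cpow_neg_one]
  rw [h1, div_self two_ne_zero, Gamma_one]
  push_cast
  field_simp
  ring

lemma twoXi_four : twoXi 4 = (2 * Real.pi ^ 2 / 15 : ℝ) := by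
  rw [twoXi_eq_of_re_pos (by simp) (by norm_num), riemannZeta_four, Gammaℝ_def]
  have hpi : (Real.pi : ℂ) ≠ 0 := by exact_mod_cast Real.pi_ne_zero
  have h1 : (Real.pi : ℂ) ^ (-4 / 2 : ℂ) = ((Real.pi : ℂ) ^ 2)⁻¹ := by
    rw [show (-4 / 2 : ℂ) = -(2 : ℕ) by norm_num, cpow_neg, cpow_natCast]
  have h2 : Gamma (4 / 2 : ℂ) = 1 := by
    rw [show (4 / 2 : ℂ) = 1 + 1 by norm_num, Gamma_add_one _ one_ne_zero, Gamma_one, mul_one]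
  rw [h1, h2]
  push_cast
  field_simp
  ring

/-- `twoXi` grows at most like `exp (C * R * log R)`. -/
lemma exists_norm_twoXi_le : ∃ K : ℝ, 1 ≤ K ∧ ∀ᶠ N : ℕ in atTop,
    ∀ z ∈ sphere (0 : ℂ) (3 * N),
      ‖twoXi z‖ ≤ Real.exp (Real.log K + 2 * N + 2 * N * Real.log (2 * N)) := by
  obtain ⟨C, hC⟩ := exists_norm_completedRiemannZeta₀_le (-1) 2
  set Z := ∑' n : ℕ, 1 / (n : ℝ) ^ 2
  have hZ : 0 ≤ Z := tsum_nonneg fun n ↦ by positivity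
  set D := |C| + Z + 2
  have hD : 2 ≤ D := by have := abs_nonneg C; simp only [D]; linarith
  refine ⟨13 * D, by linarith, ?_⟩
  filter_upwards [eventually_ge_atTop 1] with N hN z hz
  have hN' : (1 : ℝ) ≤ N := by exact_mod_cast hN
  have hzN : ‖z‖ = 3 * N := by simpa using hz
  have hre := abs_le.1 ((abs_re_le_norm z).trans_eq hzN)
  have hfac : (1 : ℝ) ≤ (2 * N).factorial := by exact_mod_cast (2 * N).factorial_pos
  have hΛ : ‖completedRiemannZeta₀ z‖ ≤ D * (2 * N).factorial := by
    have h2 : Z * (2 * N).factorial + 2 ≤ D * (2 * N).factorial := by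
      simp only [D]
      nlinarith [abs_nonneg C]
    rcases le_total z.re 2 with h | h
    · rcases le_total (-1) z.re with h' | h'
      · calc _ ≤ C := hC z h' h
          _ ≤ D * 1 := by have := le_abs_self C; simp only [D]; linarith
          _ ≤ _ := by gcongr
      · rw [← completedRiemannZeta₀_one_sub]
        refine (norm_completedRiemannZeta₀_le_factorial (n := 2 * N) ?_ ?_).trans h2
        · simp; linarith
        · push_cast; simp; linarith
    · refine (norm_completedRiemannZeta₀_le_factorial (n := 2 * N) h ?_).trans h2
      push_cast; linarith
  have h1 : ‖z - 1‖ ≤ 3 * N + 1 := by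
    refine (norm_sub_le _ _).trans ?_
    rw [hzN, norm_one]
  have hpow : ((2 * N).factorial : ℝ) ≤ Real.exp (2 * N * Real.log (2 * N)) := by
    have h3 : ((2 * N).factorial : ℝ) ≤ (2 * N : ℝ) ^ (2 * N) := by
      exact_mod_cast (2 * N).factorial_le_pow
    refine h3.trans_eq ?_
    rw [mul_comm (2 * N : ℝ) (Real.log _), Real.exp_mul, Real.exp_log (by positivity),
      ← Real.rpow_natCast]
    push_cast
    rfl
  have hNexp : (N : ℝ) ^ 2 ≤ Real.exp (2 * N) := by
    rw [two_mul, Real.exp_add, sq]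
    have := Real.add_one_le_exp (N : ℝ)
    gcongr <;> linarith
  calc ‖twoXi z‖ ≤ ‖z‖ * ‖z - 1‖ * ‖completedRiemannZeta₀ z‖ + 1 := by
        refine (norm_add_le _ _).trans ?_
        rw [norm_mul, norm_mul, norm_one]
    _ ≤ 3 * N * (3 * N + 1) * (D * (2 * N).factorial) + 1 := by rw [hzN]; gcongr
    _ ≤ 12 * N ^ 2 * (D * (2 * N).factorial) + N ^ 2 * (D * (2 * N).factorial) := by
        have h5 : 1 ≤ D * (2 * N).factorial := by nlinarith
        have h6 : 3 * N * (3 * N + 1) ≤ 12 * (N : ℝ) ^ 2 := by nlinarith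
        have h7 : 1 ≤ (N : ℝ) ^ 2 * (D * (2 * N).factorial) :=
          one_le_mul_of_one_le_of_one_le (one_le_pow₀ hN') h5
        exact add_le_add (mul_le_mul_of_nonneg_right h6 (by linarith)) h7
    _ = 13 * D * N ^ 2 * (2 * N).factorial := by ring
    _ ≤ 13 * D * Real.exp (2 * N) * Real.exp (2 * N * Real.log (2 * N)) := by gcongr
    _ = _ := by rw [Real.exp_add, Real.exp_add, Real.exp_log (by linarith)]

lemma tendsto_growth_div_sq (a : ℝ) :
    Tendsto (fun N : ℕ ↦ (a + 2 * N + 2 * N * Real.log (2 * N)) / (N : ℝ) ^ 2) atTop (𝓝 0) := by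
  have hN : Tendsto (fun N : ℕ ↦ (N : ℝ)) atTop atTop := tendsto_natCast_atTop_atTop
  have h1 : Tendsto (fun N : ℕ ↦ (N : ℝ)⁻¹) atTop (𝓝 0) := tendsto_inv_atTop_zero.comp hN
  have h2 : Tendsto (fun N : ℕ ↦ Real.log (2 * N) / (2 * N)) atTop (𝓝 0) := by
    have h := Real.isLittleO_log_id_atTop.tendsto_div_nhds_zero
    exact h.comp (hN.const_mul_atTop (two_pos (α := ℝ)))
  have h3 : Tendsto (fun N : ℕ ↦ a * ((N : ℝ)⁻¹ * (N : ℝ)⁻¹) + 2 * (N : ℝ)⁻¹ +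
      4 * (Real.log (2 * N) / (2 * N))) atTop (𝓝 0) := by
    simpa using (((h1.mul h1).const_mul a).add (h1.const_mul 2)).add (h2.const_mul 4)
  refine h3.congr' ?_
  filter_upwards [eventually_ge_atTop 1] with N hN
  have : (N : ℝ) ≠ 0 := by positivity
  field_simp
  ring

lemma exists_twoXi_growth : ∃ B : ℕ → ℝ, (∀ᶠ N in atTop, 0 < B N) ∧
    (∀ᶠ N : ℕ in atTop, ∀ z ∈ sphere (0 : ℂ) (3 * N), ‖twoXi z‖ ≤ Real.exp (B N)) ∧
    Tendsto (fun N : ℕ ↦ B N / (N : ℝ) ^ 2) atTop (𝓝 0) := by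
  obtain ⟨K, hK, hB⟩ := exists_norm_twoXi_le
  refine ⟨_, ?_, hB, tendsto_growth_div_sq (Real.log K)⟩
  filter_upwards [eventually_ge_atTop 1] with N hN
  have hN' : (1 : ℝ) ≤ N := by exact_mod_cast hN
  have h1 := Real.log_nonneg hK
  have h2 : 0 ≤ Real.log (2 * N) := Real.log_nonneg (by linarith)
  positivity

lemma exists_twoXi_eq_zero : ∃ ρ, twoXi ρ = 0 := by
  by_contra! h
  obtain ⟨B, hB0, hB, hlim⟩ := exists_twoXi_growth
  have h2 := mul_one_sub_eq_one_of_ne_zero differentiable_twoXi twoXi_zero twoXi_one h hB0 hB hlim 2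
  rw [twoXi_one_sub, twoXi_two, ← ofReal_mul, ofReal_eq_one] at h2
  nlinarith [Real.pi_gt_d2]

lemma lt_abs_im_of_twoXi_eq_zero {ρ : ℂ} (h : twoXi ρ = 0) : 9.3 < |ρ.im| := by
  by_contra! ht
  obtain ⟨B, hB0, hB, hlim⟩ := exists_twoXi_growth
  obtain ⟨h0, h1⟩ := re_mem_Ioo_of_twoXi_eq_zero h
  have key := mul_norm_le_of_zero differentiable_twoXi twoXi_zero twoXi_one
    (fun ρ hρ ↦ re_mem_Ioo_of_twoXi_eq_zero hρ) hB0 hB hlim h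
    (norm_one_add_div_mul_one_sub_le_of_abs_im_le h0 h1 ht)
  have e1 : twoXi (-1) = twoXi 2 := by rw [← twoXi_one_sub]; norm_num
  have e2 : twoXi (-3) = twoXi 4 := by rw [← twoXi_one_sub]; norm_num
  rw [e1, e2, twoXi_two, twoXi_four, norm_mul, norm_mul, norm_real, norm_real, Real.norm_eq_abs,
    Real.norm_eq_abs, abs_mul_abs_self, abs_mul_abs_self] at key
  have hpi : Real.pi ^ 8 ≤ 3.1416 ^ 8 := by
    have := Real.pi_lt_d4
    gcongr
  have hpi4 : 0 < Real.pi ^ 4 := by positivity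
  have key' : Real.pi ^ 4 * (1.006 * (4 / 225)) ≤ Real.pi ^ 4 * (Real.pi ^ 8 / 3 ^ 12) := by
    convert! key using 1 <;> ring
  have := le_of_mul_le_mul_left key' hpi4
  norm_num at this hpi
  linarith

theorem min_imag_part_of_zero_gt :
    sInf {t : ℝ | ∃ ρ : ℂ, riemannZeta ρ = 0 ∧ 0 < ρ.re ∧ ρ.re < 1 ∧ t = |ρ.im|} >
      9.2518015 := by
  obtain ⟨ρ, hρ⟩ := exists_twoXi_eq_zero
  obtain ⟨h0, h1⟩ := re_mem_Ioo_of_twoXi_eq_zero hρ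
  refine lt_of_lt_of_le (by norm_num : (9.2518015 : ℝ) < 9.3) (le_csInf
    ⟨_, ρ, (twoXi_eq_zero_iff h0 h1).1 hρ, h0, h1, rfl⟩ ?_)
  rintro _ ⟨ρ', hρ', h0', h1', rfl⟩
  exact (lt_abs_im_of_twoXi_eq_zero ((twoXi_eq_zero_iff h0' h1').2 hρ')).le
end
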